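/- There exist constants C > 0 and n₀ ≥ 1 (depending only on the offspring distribution (p_i)) such that for all M ≥ n₀ and all n ≥ M with n ∈ I: Σ_{k=M}^{n} E_{τ_n}[Z_k]·log k ≤ C·n·(log M)/√M + (2 + 4√2·α)·n^{3/4}·log n. -/

import Mathlib

/-! Finite ordered rooted (plane) trees: a tree is a finite list of its root subtrees. -/
inductive PTree : Type where
  | node : List PTree → PTree

namespace PTree

/-- the number of nodes of the tree -/
def size : PTree → ℕ
  | node ts => 1 + (ts.attach.map (fun x => size x.1)).sum
decreasing_by
  have := List.sizeOf_lt_of_mem x.2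
  simp only [node.sizeOf_spec]; omega

/-- the list of all subtrees rooted at the nodes of the tree -/
def subtrees : PTree → List PTree
  | node ts => node ts :: (ts.attach.map (fun x => subtrees x.1)).flatten
decreasing_by
  have := List.sizeOf_lt_of_mem x.2
  simp only [node.sizeOf_spec]; omega

/-- the height of the tree (maximal distance from the root to a node) -/
def height : PTree → ℕ
  | node ts => (ts.attach.map (fun x => height x.1 + 1)).foldr max 0
decreasing_by
  have := List.sizeOf_lt_of_mem x.2
  simp only [node.sizeOf_spec]; omega

/-- the number of children of the root (`ξ_ε`) -/
def rootDeg : PTree → ℕ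
  | node ts => ts.length

/-- the sizes of the subtrees rooted at the children of the root -/
def childSizes : PTree → List ℕ
  | node ts => ts.map size

/-- the sizes of the subtrees rooted at the children of the root,
sorted from largest to smallest -/
def sortedSizesDesc (T : PTree) : List ℕ :=
  T.childSizes.insertionSort (· ≥ ·)

/-- `N_k`: the `k`-th largest among the sizes of the subtrees rooted at the children
of the root (`0` if there are fewer than `k` children) -/
def Nk (k : ℕ) (T : PTree) : ℕ := (sortedSizesDesc T).getD (k - 1) 0

/-- `N_{k+} = N_k + N_{k+1} + ⋯` -/
def NkPlus (k : ℕ) (T : PTree) : ℕ := ((sortedSizesDesc T).drop (k - 1)).sum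

/-- the subtrees rooted at the nodes of the heavy path: starting at the root, always
continue to the first child of maximal subtree size -/
def heavyPath : PTree → List PTree
  | node ts =>
    node ts ::
      (match ts.attach.find? (fun x => x.1.size = ((ts.map size).foldr max 0)) with
       | some x => heavyPath x.1
       | none => [])
decreasing_by
  have := List.sizeOf_lt_of_mem x.2
  simp only [node.sizeOf_spec]; omega

end PTree

/-- `Z_k`: the number of nodes `v` of the tree whose subtree has size `k` -/
def Zk (k : ℕ) (T : PTree) : ℕ := (T.subtrees.filter (fun s => s.size = k)).length

/-- the rank (`1` = largest) of the `i`-th child (0-based) among siblings whose subtree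
sizes are given by the list `sizes`; ties are broken from left to right -/
def rankIn (sizes : List ℕ) (i : ℕ) : ℕ :=
  1 + ((List.range sizes.length).filter (fun j =>
        sizes.getD i 0 < sizes.getD j 0 ∨ (sizes.getD j 0 = sizes.getD i 0 ∧ j < i))).length

mutual
/-- the number of nodes of the `k`-heavy tree: the root together with all nodes `v` such
that `v` and every non-root ancestor of `v` has rank at most `k` among its siblings -/
def heavySize (k : ℕ) : PTree → ℕ
  | .node ts => 1 + heavySizeAux k (ts.map PTree.size) 0 ts
def heavySizeAux (k : ℕ) (sizes : List ℕ) : ℕ → List PTree → ℕ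
  | _, [] => 0
  | i, t :: rest =>
      (if rankIn sizes i ≤ k then heavySize k t else 0) + heavySizeAux k sizes (i + 1) rest
end

/-- `H*(v,ℓ)`: the height of the subtree rooted at the child of rank `ℓ` of the root of `v`
(`0` if there are fewer than `ℓ` children) -/
def Hstar : PTree → ℕ → ℕ
  | .node ts, ℓ =>
    match (List.range ts.length).find? (fun i => rankIn (ts.map PTree.size) i = ℓ) with
    | some i => (ts.getD i (.node [])).height
    | none => 0

/-- the weight of a tree: the product over all nodes `v` of `p (number of children of v)` -/
noncomputable def weight (p : ℕ → ℝ) : PTree → ℝ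
  | .node ts => p ts.length * (ts.attach.map (fun x => weight p x.1)).prod
decreasing_by
  have := List.sizeOf_lt_of_mem x.2
  simp only [PTree.node.sizeOf_spec]; omega

/-- the total weight of all trees of size `n` -/
noncomputable def treeSum (p : ℕ → ℝ) (n : ℕ) : ℝ :=
  ∑' T : {T : PTree // T.size = n}, weight p T.1

/-- the probability of the event `A` under the conditional Galton-Watson tree `τ_n` -/
noncomputable def condProb (p : ℕ → ℝ) (n : ℕ) (A : PTree → Prop) : ℝ :=
  (∑' T : {T : PTree // T.size = n ∧ A T}, weight p T.1) / treeSum p n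

/-- the expectation of `f` under the conditional Galton-Watson tree `τ_n` -/
noncomputable def condExp (p : ℕ → ℝ) (n : ℕ) (f : PTree → ℝ) : ℝ :=
  (∑' T : {T : PTree // T.size = n}, weight p T.1 * f T.1) / treeSum p n

/-- the variance of `f` under the conditional Galton-Watson tree `τ_n` -/
noncomputable def condVar (p : ℕ → ℝ) (n : ℕ) (f : PTree → ℝ) : ℝ :=
  condExp p n (fun T => f T ^ 2) - (condExp p n f) ^ 2

/-- the set `I = {n ≥ 1 : Σ_{|T| = n} w(T) > 0}` of sizes of positive probability -/
def gwSupport (p : ℕ → ℝ) : Set ℕ := {n | 1 ≤ n ∧ 0 < treeSum p n}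

/-- `P(S_m = x)` for the random walk `S_m = (ξ_1 - 1) + ⋯ + (ξ_m - 1)`, `ξ_i` i.i.d. `∼ p` -/
noncomputable def walkProb (p : ℕ → ℝ) (m : ℕ) (x : ℤ) : ℝ :=
  ∑' a : Fin m → ℕ, if (∑ i, ((a i : ℤ) - 1)) = x then ∏ i, p (a i) else 0

/-- `I_n = {1 ≤ k ≤ n : P(S_{n-k} = 0) > 0}` -/
def walkSupportIn (p : ℕ → ℝ) (n : ℕ) : Set ℕ :=
  {k | 1 ≤ k ∧ k ≤ n ∧ 0 < walkProb p (n - k) 0}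

/-- `h = gcd {i > 0 : p_i > 0}`, defined as the largest common divisor of the support -/
noncomputable def gcdSupp (p : ℕ → ℝ) : ℕ :=
  sSup {d : ℕ | 0 < d ∧ ∀ i : ℕ, 0 < i → 0 < p i → d ∣ i}

/-- `α = h / (σ √(2π))` where `σ² = Σ i² p_i - 1` -/
noncomputable def gwAlpha (p : ℕ → ℝ) : ℝ :=
  (gcdSupp p : ℝ) /
    (Real.sqrt ((∑' i : ℕ, (i : ℝ) ^ 2 * p i) - 1) * Real.sqrt (2 * Real.pi))

/-- the moment `E[ξ^m] = Σ i^m p_i` is finite -/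
def MomentFinite (p : ℕ → ℝ) (m : ℝ) : Prop :=
  Summable (fun i : ℕ => (i : ℝ) ^ m * p i)

namespace PTree

theorem size_node (ts : List PTree) : (node ts).size = 1 + (ts.map size).sum := by
  rw [size, List.attach_map_val (f := size)]

theorem subtrees_node (ts : List PTree) :
    (node ts).subtrees = node ts :: (ts.map subtrees).flatten := by
  rw [subtrees, List.attach_map_val (f := subtrees)]

theorem size_pos (T : PTree) : 0 < T.size := by
  cases T; rw [size_node]; omega

/-- Remove the root of the first tree of a forest after grafting: the first `i` trees of `F`
become the root subtrees of a new first tree. -/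
def graft (i : ℕ) (F : List PTree) : List PTree := node (F.take i) :: F.drop i

/-- The finite set of forests with `r` trees and `n` nodes in total. -/
noncomputable def forests : ℕ → ℕ → Finset (List PTree)
  | 0, 0 => {[]}
  | 0, _ + 1 => ∅
  | _ + 1, 0 => ∅
  | n + 1, r + 1 =>
    open Classical in
    (Finset.range (n + 1)).biUnion fun i => (forests n (r + i)).image (graft i)

theorem length_le_sum_size (F : List PTree) : F.length ≤ (F.map size).sum := by
  induction F with
  | nil => simp
  | cons t F ih =>
    have := t.size_pos
    simp only [List.length_cons, List.map_cons, List.sum_cons]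
    omega

theorem mem_forests {n r : ℕ} {F : List PTree} :
    F ∈ forests n r ↔ F.length = r ∧ (F.map size).sum = n := by
  induction n generalizing r F with
  | zero =>
    cases r with
    | zero => cases F <;> simp [forests]
    | succ r =>
      have := length_le_sum_size F
      simp only [forests, Finset.notMem_empty, false_iff]
      omega
  | succ n ih =>
    cases r with
    | zero => cases F <;> simp [forests]
    | succ r =>
      simp only [forests, Finset.mem_biUnion, Finset.mem_range, Finset.mem_image, ih]
      constructor
      · rintro ⟨i, hi, G, ⟨hl, hs⟩, rfl⟩
        have h : ((G.take i).map size).sum + ((G.drop i).map size).sum = n := by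
          rw [← List.sum_append, ← List.map_append, List.take_append_drop, hs]
        simp only [graft, List.length_cons, List.length_drop, List.map_cons, List.sum_cons,
          size_node]
        omega
      · rintro ⟨hl, hs⟩
        match F, hl, hs with
        | node ts :: F, hl, hs =>
          have := length_le_sum_size ts
          simp only [List.length_cons, List.map_cons, List.sum_cons, size_node] at hl hs
          refine ⟨ts.length, by omega, ts ++ F, ⟨by simp; omega, by simp; omega⟩, ?_⟩
          simp [graft]

theorem sum_forests_succ (n r : ℕ) (f : List PTree → ℝ) :
    ∑ F ∈ forests (n + 1) (r + 1), f F =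
      ∑ i ∈ Finset.range (n + 1), ∑ F ∈ forests n (r + i), f (graft i F) := by
  classical
  rw [forests, Finset.sum_biUnion]
  · refine Finset.sum_congr rfl fun i _ => ?_
    rw [Finset.sum_image]
    intro F _ G _ h
    simp only [graft, List.cons.injEq, node.injEq] at h
    rw [← List.take_append_drop i F, h.1, h.2, List.take_append_drop]
  · intro i _ j _ hij
    rw [Function.onFun, Finset.disjoint_left]
    intro H hi hj
    simp only [Finset.mem_image, mem_forests] at hi hj
    obtain ⟨F, ⟨hF, -⟩, rfl⟩ := hi
    obtain ⟨G, ⟨hG, -⟩, h⟩ := hj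
    simp only [graft, List.cons.injEq, node.injEq] at h
    have := congrArg List.length h.1
    simp only [List.length_take] at this
    omega

theorem forests_eq_empty {n r : ℕ} (h : n < r) : forests n r = ∅ := by
  ext F
  have := length_le_sum_size F
  simp only [mem_forests, Finset.notMem_empty, iff_false]
  omega

/-- Summing over trees of size `n` is summing over forests with a single tree. -/
theorem tsum_size_eq (n : ℕ) (f : PTree → ℝ) (g : List PTree → ℝ) (h : ∀ T, g [T] = f T) :
    ∑' T : {T : PTree // T.size = n}, f T.1 = ∑ F ∈ forests n 1, g F := by
  let e : {T : PTree // T.size = n} ≃ {F // F ∈ forests n 1} :=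
    { toFun T := ⟨[T.1], by simp [mem_forests, T.2]⟩
      invFun F := ⟨F.1.headD (node []), by
        obtain ⟨F, hF⟩ := F
        rw [mem_forests, List.length_eq_one_iff] at hF
        obtain ⟨⟨T, rfl⟩, h⟩ := hF
        simpa using h⟩
      left_inv T := by simp
      right_inv F := by
        obtain ⟨F, hF⟩ := F
        have hF' := hF
        rw [mem_forests, List.length_eq_one_iff] at hF'
        obtain ⟨⟨T, rfl⟩, h⟩ := hF'
        simp }
  rw [← Finset.tsum_subtype, ← e.tsum_eq]
  exact tsum_congr fun T => (h T.1).symm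

end PTree

theorem weight_node (p : ℕ → ℝ) (ts : List PTree) :
    weight p (.node ts) = p ts.length * (ts.map (weight p)).prod := by
  rw [weight, List.attach_map_val (f := weight p)]

theorem Zk_node (k : ℕ) (ts : List PTree) :
    Zk k (.node ts) = (if (PTree.node ts).size = k then 1 else 0) + (ts.map (Zk k)).sum := by
  have h : ((ts.map PTree.subtrees).flatten.filter (fun s => s.size = k)).length =
      (ts.map (Zk k)).sum := by
    induction ts with
    | nil => simp
    | cons t ts ih =>
      simp only [List.map_cons, List.flatten_cons, List.filter_append, List.length_append, ih,
        List.sum_cons, Zk]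
  rw [Zk, PTree.subtrees_node, List.filter_cons]
  split_ifs with h₁ h₂ h₂
  · rw [List.length_cons, h]; omega
  · exact absurd (by simpa using h₁) h₂
  · exact absurd (by simpa using h₂) h₁
  · rw [h]; omega

namespace GaltonWatson

open PTree

/-- The product of the weights of the trees of a forest. -/
noncomputable def forestWeight (p : ℕ → ℝ) (F : List PTree) : ℝ := (F.map (weight p)).prod

/-- The number of nodes of a forest whose subtree has size `k`. -/
noncomputable def forestZ (k : ℕ) (F : List PTree) : ℕ := (F.map (Zk k)).sum

/-- The total weight of the forests with `r` trees and `n` nodes. -/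
noncomputable def forestSum (p : ℕ → ℝ) (n r : ℕ) : ℝ := ∑ F ∈ forests n r, forestWeight p F

/-- The weighted count of nodes with subtree size `k` in forests with `r` trees and `n` nodes. -/
noncomputable def forestZSum (p : ℕ → ℝ) (k n r : ℕ) : ℝ :=
  ∑ F ∈ forests n r, forestWeight p F * forestZ k F

/-- The probability that `m` independent `p`-distributed variables add up to `s`. -/
noncomputable def sumProb (p : ℕ → ℝ) (m s : ℕ) : ℝ := PowerSeries.coeff s (PowerSeries.mk p ^ m)

variable {p : ℕ → ℝ}

theorem treeSum_eq (n : ℕ) : treeSum p n = forestSum p n 1 :=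
  tsum_size_eq n _ _ fun T => by simp [forestWeight]

theorem condExp_Zk_eq (k n : ℕ) :
    condExp p n (fun T => (Zk k T : ℝ)) = forestZSum p k n 1 / forestSum p n 1 := by
  rw [condExp, treeSum_eq]
  congr 1
  exact tsum_size_eq n (fun T => weight p T * (Zk k T : ℝ)) _ fun T => by
    simp [forestWeight, forestZ]

theorem forestWeight_graft {r i : ℕ} {F : List PTree} (hF : F.length = r + i) :
    forestWeight p (graft i F) = p i * forestWeight p F := by
  have h : (F.take i).length = i := by simp; omega
  rw [forestWeight, graft, List.map_cons, List.prod_cons, weight_node, h, mul_assoc,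
    ← List.prod_append, ← List.map_append, List.take_append_drop, forestWeight]

theorem forestZ_graft (k i : ℕ) (F : List PTree) :
    forestZ k (graft i F) = (if (node (F.take i)).size = k then 1 else 0) + forestZ k F := by
  rw [forestZ, graft, List.map_cons, List.sum_cons, Zk_node, add_assoc,
    ← List.sum_append, ← List.map_append, List.take_append_drop, forestZ]

theorem forestSum_zero_zero : forestSum p 0 0 = 1 := by
  simp [forestSum, forests, forestWeight]

theorem forestSum_of_lt {n r : ℕ} (h : n < r) : forestSum p n r = 0 := by
  simp [forestSum, forests_eq_empty h]

theorem forestSum_succ_zero (n : ℕ) : forestSum p (n + 1) 0 = 0 := by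
  simp [forestSum, forests]

theorem forestSum_succ (n r : ℕ) :
    forestSum p (n + 1) (r + 1) = ∑ i ∈ Finset.range (n + 1), p i * forestSum p n (r + i) := by
  rw [forestSum, sum_forests_succ]
  refine Finset.sum_congr rfl fun i _ => ?_
  rw [forestSum, Finset.mul_sum]
  exact Finset.sum_congr rfl fun F hF => forestWeight_graft (mem_forests.1 hF).1

/-- The total weight of forests whose first tree has size `k`. -/
theorem sum_headSize (k m r : ℕ) :
    ∑ F ∈ forests (m + k) (r + 1),
      forestWeight p F * (if (F.headD (node [])).size = k then 1 else 0) =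
      forestSum p k 1 * forestSum p m r := by
  rw [forestSum, forestSum, Finset.sum_mul_sum, ← Finset.sum_product']
  simp only [mul_ite, mul_one, mul_zero]
  rw [← Finset.sum_filter]
  symm
  refine Finset.sum_bij' (fun x _ => x.1 ++ x.2) (fun F _ => (F.take 1, F.drop 1)) ?_ ?_ ?_ ?_ ?_
  · rintro ⟨F, G⟩ h
    simp only [Finset.mem_product, mem_forests, List.length_eq_one_iff] at h
    obtain ⟨⟨⟨T, rfl⟩, h1⟩, h2, h3⟩ := h
    simp at h1
    simp [mem_forests, h1, h2, h3, add_comm]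
  · rintro F h
    simp only [Finset.mem_filter, mem_forests] at h
    match F, h with
    | T :: F, h =>
      simp at h
      simp only [Finset.mem_product, mem_forests]
      simp
      omega
  · rintro ⟨F, G⟩ h
    simp only [Finset.mem_product, mem_forests, List.length_eq_one_iff] at h
    obtain ⟨⟨⟨T, rfl⟩, h1⟩, h2, h3⟩ := h
    simp
  · rintro F h
    simp only [Finset.mem_filter, mem_forests] at h
    match F, h with
    | T :: F, h => simp
  · simp [forestWeight]

theorem forestZSum_succ (k m r n : ℕ) (hn : m + k = n + 1) :
    forestZSum p k (n + 1) (r + 1) = forestSum p k 1 * forestSum p m r +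
      ∑ i ∈ Finset.range (n + 1), p i * forestZSum p k n (r + i) := by
  rw [← sum_headSize, hn, forestZSum, sum_forests_succ, sum_forests_succ, ← Finset.sum_add_distrib]
  refine Finset.sum_congr rfl fun i _ => ?_
  rw [forestZSum, Finset.mul_sum, ← Finset.sum_add_distrib]
  refine Finset.sum_congr rfl fun F hF => ?_
  rw [forestWeight_graft (mem_forests.1 hF).1, forestZ_graft]
  simp only [graft, List.headD_cons]
  by_cases hk : (node (F.take i)).size = k <;> simp only [hk, if_true, if_false] <;> push_cast <;>
    ring

theorem forestZ_eq_zero {k : ℕ} {F : List PTree} (h : (F.map size).sum < k + (F.length - 1)) :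
    forestZ k F = 0 := by
  generalize hn : (F.map size).sum = n at h
  induction n generalizing F with
  | zero =>
    have := length_le_sum_size F
    have : F = [] := List.length_eq_zero_iff.1 (by omega)
    simp [this, forestZ]
  | succ n ih =>
    match F, hn, h with
    | node ts :: F, hn, h =>
      have hg : node ts :: F = graft ts.length (ts ++ F) := by simp [graft]
      have := length_le_sum_size F
      simp only [List.map_cons, List.sum_cons, List.length_cons, size_node] at hn h
      rw [hg, forestZ_graft, ih (by simp; omega) (by simp; omega), if_neg]
      simp only [List.take_left', size_node]
      omega

theorem forestZSum_of_lt {k n r : ℕ} (h : n < k + (r - 1)) : forestZSum p k n r = 0 := by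
  refine Finset.sum_eq_zero fun F hF => ?_
  rw [mem_forests] at hF
  rw [forestZ_eq_zero (by omega)]
  simp

theorem sumProb_succ (m s : ℕ) :
    sumProb p (m + 1) s = ∑ i ∈ Finset.range (s + 1), p i * sumProb p m (s - i) := by
  rw [sumProb, pow_succ', PowerSeries.coeff_mul, Finset.Nat.sum_antidiagonal_eq_sum_range_succ_mk]
  simp [sumProb]

theorem sumProb_weighted (m s : ℕ) :
    (m + 1) * ∑ i ∈ Finset.range (s + 1), i * (p i * sumProb p m (s - i)) =
      s * sumProb p (m + 1) s := by
  have h : (PowerSeries.X * PowerSeries.derivative ℝ (PowerSeries.mk p ^ (m + 1)) : PowerSeries ℝ)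
      = (m + 1 : ℕ) • ((PowerSeries.X * PowerSeries.derivative ℝ (PowerSeries.mk p)) *
        PowerSeries.mk p ^ m) := by
    have := Derivation.leibniz_pow (PowerSeries.derivative ℝ) (PowerSeries.mk p) (m + 1)
    simp only [Nat.add_sub_cancel, smul_eq_mul] at this
    rw [this]
    simp only [nsmul_eq_mul]
    ring
  have hX : ∀ (f : PowerSeries ℝ) (s : ℕ), PowerSeries.coeff s
      (PowerSeries.X * PowerSeries.derivative ℝ f) = s * PowerSeries.coeff s f := by
    intro f s
    cases s with
    | zero => simp
    | succ s =>
      rw [PowerSeries.coeff_succ_X_mul, PowerSeries.coeff_derivative]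
      push_cast; ring
  have h2 := congrArg (PowerSeries.coeff s) h
  rw [hX, map_nsmul, PowerSeries.coeff_mul, Finset.Nat.sum_antidiagonal_eq_sum_range_succ_mk] at h2
  simp only [hX, PowerSeries.coeff_mk, nsmul_eq_mul] at h2
  rw [sumProb, h2]
  push_cast
  congr 1
  exact Finset.sum_congr rfl fun i _ => by rw [sumProb]; ring

theorem sumProb_zero_zero : sumProb p 0 0 = 1 := by simp [sumProb]

theorem sumProb_linear (r : ℝ) (m s : ℕ) :
    (m + 1) * ∑ i ∈ Finset.range (s + 1), p i * ((r + i) * sumProb p m (s - i)) =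
      ((m + 1) * r + s) * sumProb p (m + 1) s := by
  have h := sumProb_weighted (p := p) m s
  have h1 : ∑ i ∈ Finset.range (s + 1), p i * ((r + i) * sumProb p m (s - i)) =
      r * sumProb p (m + 1) s +
        ∑ i ∈ Finset.range (s + 1), i * (p i * sumProb p m (s - i)) := by
    rw [sumProb_succ, Finset.mul_sum, ← Finset.sum_add_distrib]
    exact Finset.sum_congr rfl fun i _ => by ring
  rw [h1, mul_add, h]
  ring

/-- The hitting time (Otter-Dwass, Kemperman) formula. -/
theorem mul_forestSum (n r : ℕ) (h : r ≤ n) :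
    n * forestSum p n r = r * sumProb p n (n - r) := by
  induction n generalizing r with
  | zero =>
    obtain rfl : r = 0 := by omega
    simp
  | succ n ih =>
    cases r with
    | zero => simp [forestSum_succ_zero]
    | succ r =>
      obtain ⟨s, rfl⟩ : ∃ s, n = r + s := ⟨n - r, by omega⟩
      have hs : forestSum p (r + s + 1) (r + 1) =
          ∑ i ∈ Finset.range (s + 1), p i * forestSum p (r + s) (r + i) := by
        rw [forestSum_succ]
        symm
        refine Finset.sum_subset (Finset.range_mono (by omega)) fun i _ hi => ?_
        rw [Finset.mem_range] at hi
        rw [forestSum_of_lt (by omega), mul_zero]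
      rw [show r + s + 1 - (r + 1) = s by omega]
      rcases Nat.eq_zero_or_pos (r + s) with h0 | h0
      · obtain ⟨rfl, rfl⟩ : r = 0 ∧ s = 0 := by omega
        rw [hs]
        simp [forestSum_zero_zero, sumProb]
      · have h1 : ((r + s : ℕ) : ℝ) * forestSum p (r + s + 1) (r + 1) =
            ∑ i ∈ Finset.range (s + 1), p i * ((r + i) * sumProb p (r + s) (s - i)) := by
          rw [hs, Finset.mul_sum]
          refine Finset.sum_congr rfl fun i hi => ?_
          rw [Finset.mem_range] at hi
          have := ih (r + i) (by omega)
          rw [show r + s - (r + i) = s - i by omega] at this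
          push_cast at this ⊢
          linear_combination p i * this
        have h2 := sumProb_linear (p := p) (r : ℝ) (r + s) s
        rw [← h1] at h2
        have h3 : ((r + s : ℕ) : ℝ) ≠ 0 := by positivity
        apply mul_left_cancel₀ h3
        push_cast at h2 ⊢
        linear_combination h2

theorem forestZSum_eq (k m r : ℕ) (hk : 0 < k) (h : r ≤ m + 1) :
    forestZSum p k (m + k) r = r * (forestSum p k 1 * sumProb p m (m + 1 - r)) := by
  induction m generalizing r with
  | zero =>
    obtain ⟨k, rfl⟩ : ∃ j, k = j + 1 := ⟨k - 1, by omega⟩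
    cases r with
    | zero => simp [forestZSum, forests]
    | succ r =>
      obtain rfl : r = 0 := by omega
      rw [zero_add, forestZSum_succ (k + 1) 0 0 k (by omega), Finset.sum_eq_zero]
      · simp [forestSum_zero_zero, sumProb_zero_zero]
      · intro i _
        rw [forestZSum_of_lt (by omega), mul_zero]
  | succ m ih =>
    cases r with
    | zero =>
      rw [show m + 1 + k = (m + k) + 1 by omega]
      simp [forestZSum, forests]
    | succ r =>
      obtain ⟨s, hs⟩ : ∃ s, m + 1 = r + s := ⟨m + 1 - r, by omega⟩
      have h1 : ∑ i ∈ Finset.range (m + k + 1), p i * forestZSum p k (m + k) (r + i) =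
          forestSum p k 1 *
            ∑ i ∈ Finset.range (s + 1), p i * ((r + i) * sumProb p m (s - i)) := by
        rw [Finset.mul_sum]
        symm
        calc _ = ∑ i ∈ Finset.range (s + 1), p i * forestZSum p k (m + k) (r + i) := by
              refine Finset.sum_congr rfl fun i hi => ?_
              rw [Finset.mem_range] at hi
              rw [ih (r + i) (by omega), show m + 1 - (r + i) = s - i by omega]
              push_cast
              ring
          _ = _ := by
              refine Finset.sum_subset (Finset.range_mono (by omega)) fun i _ hi => ?_
              rw [Finset.mem_range] at hi
              rw [forestZSum_of_lt (by omega), mul_zero]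
      rw [show m + 1 + k = (m + k) + 1 by omega, forestZSum_succ k (m + 1) r (m + k) (by omega),
        h1, show m + 1 + 1 - (r + 1) = s by omega]
      have h2 := sumProb_linear (p := p) (r : ℝ) m s
      have h3 := mul_forestSum (p := p) (m + 1) r (by omega)
      rw [show m + 1 - r = s by omega] at h3
      have h4 : ((m : ℝ) + 1) ≠ 0 := by positivity
      have h5 : (m : ℝ) + 1 = r + s := by exact_mod_cast hs
      apply mul_left_cancel₀ h4
      push_cast at h3 ⊢
      linear_combination forestSum p k 1 * h2 + forestSum p k 1 * h3 -
        forestSum p k 1 * sumProb p (m + 1) s * h5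

/-- The exact expectation of `Z_k` in a conditional Galton-Watson tree. -/
theorem condExp_Zk {k n : ℕ} (hk : 0 < k) (hkn : k ≤ n) :
    condExp p n (fun T => (Zk k T : ℝ)) =
      treeSum p k * sumProb p (n - k) (n - k) / treeSum p n := by
  obtain ⟨m, rfl⟩ : ∃ m, n = m + k := ⟨n - k, by omega⟩
  rw [condExp_Zk_eq, forestZSum_eq k m 1 hk (by omega), treeSum_eq, treeSum_eq]
  simp

theorem treeSum_eq_sumProb {n : ℕ} (hn : 0 < n) :
    treeSum p n = sumProb p n (n - 1) / n := by
  have := mul_forestSum (p := p) n 1 hn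
  rw [treeSum_eq, eq_div_iff (by positivity), mul_comm, this]
  simp

open MeasureTheory Filter Topology

/-- A critical offspring distribution with finite positive variance. -/
structure IsCritical (p : ℕ → ℝ) : Prop where
  nonneg : ∀ i, 0 ≤ p i
  hasSum : HasSum p 1
  hasSum_mean : HasSum (fun i : ℕ => (i : ℝ) * p i) 1
  summable_sq : Summable (fun i : ℕ => (i : ℝ) ^ 2 * p i)
  one_lt_sq : 1 < ∑' i : ℕ, (i : ℝ) ^ 2 * p i

/-- The variance of a critical offspring distribution. -/
noncomputable def offspringVar (p : ℕ → ℝ) : ℝ := (∑' i : ℕ, (i : ℝ) ^ 2 * p i) - 1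

/-- The characteristic function of the offspring distribution. -/
noncomputable def charFn (p : ℕ → ℝ) (u : ℝ) : ℂ :=
  ∑' i : ℕ, (p i : ℂ) * Complex.exp (u * Complex.I) ^ i

/-- The characteristic function of the centered offspring distribution. -/
noncomputable def centeredCharFn (p : ℕ → ℝ) (u : ℝ) : ℂ :=
  charFn p u * Complex.exp (-(u * Complex.I))

theorem norm_exp_pow (u : ℝ) (i : ℕ) : ‖Complex.exp (u * Complex.I) ^ i‖ = 1 := by
  rw [norm_pow, Complex.norm_exp_ofReal_mul_I, one_pow]

theorem norm_centeredCharFn (u : ℝ) : ‖centeredCharFn p u‖ = ‖charFn p u‖ := by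
  rw [centeredCharFn, norm_mul, ← neg_mul, ← Complex.ofReal_neg, Complex.norm_exp_ofReal_mul_I,
    mul_one]

namespace IsCritical

theorem var_pos (hp : IsCritical p) : 0 < offspringVar p := sub_pos.2 hp.one_lt_sq

theorem pos_zero (hp : IsCritical p) : 0 < p 0 := by
  refine lt_of_le_of_ne (hp.nonneg 0) fun h0 => ?_
  have h1 : HasSum (fun i : ℕ => ((i : ℝ) - 1) * p i) 0 := by
    simpa [sub_mul] using hp.hasSum_mean.sub hp.hasSum
  have h2 : ∀ i : ℕ, 0 ≤ ((i : ℝ) - 1) * p i := by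
    intro i
    cases i with
    | zero => simp [← h0]
    | succ i => exact mul_nonneg (by push_cast; linarith [Nat.cast_nonneg (α := ℝ) i]) (hp.nonneg _)
  have h3 := (hasSum_zero_iff_of_nonneg h2).1 h1
  have h4 : ∑' i : ℕ, (i : ℝ) ^ 2 * p i = 1 := by
    rw [← hp.hasSum_mean.tsum_eq]
    refine tsum_congr fun i => ?_
    have := congrFun h3 i
    simp only [Pi.zero_apply] at this
    linear_combination (i : ℝ) * this
  exact hp.one_lt_sq.ne' h4

theorem sumProb_nonneg (hp : IsCritical p) (m s : ℕ) : 0 ≤ sumProb p m s := by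
  induction m generalizing s with
  | zero => rw [sumProb, pow_zero, PowerSeries.coeff_one]; split_ifs <;> simp
  | succ m ih =>
    rw [sumProb_succ]
    exact Finset.sum_nonneg fun i _ => mul_nonneg (hp.nonneg i) (ih _)

theorem summable_norm_charFn (hp : IsCritical p) (u : ℝ) :
    Summable fun i : ℕ => ‖(p i : ℂ) * Complex.exp (u * Complex.I) ^ i‖ := by
  simpa [norm_exp_pow, abs_of_nonneg (hp.nonneg _), Complex.norm_exp_ofReal_mul_I]
    using hp.hasSum.summable

theorem hasSum_charFn_pow (hp : IsCritical p) (u : ℝ) (m : ℕ) :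
    HasSum (fun s : ℕ => (sumProb p m s : ℂ) * Complex.exp (u * Complex.I) ^ s) (charFn p u ^ m) ∧
      Summable fun s : ℕ => ‖(sumProb p m s : ℂ) * Complex.exp (u * Complex.I) ^ s‖ := by
  induction m with
  | zero =>
    have h : ∀ s, s ≠ 0 → sumProb p 0 s = 0 := fun s hs => by
      rw [sumProb, pow_zero, PowerSeries.coeff_one, if_neg hs]
    constructor
    · have := hasSum_single (f := fun s : ℕ =>
        (sumProb p 0 s : ℂ) * Complex.exp (u * Complex.I) ^ s) 0 fun s hs => by simp [h s hs]
      simpa [sumProb_zero_zero] using this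
    · exact summable_of_ne_finset_zero (s := {0}) fun s hs => by simp [h s (by simpa using hs)]
  | succ m ih =>
    have h1 := hp.summable_norm_charFn u
    have h2 := hasSum_sum_range_mul_of_summable_norm h1 ih.2
    have h3 := summable_norm_sum_mul_range_of_summable_norm h1 ih.2
    have h4 : ∀ s : ℕ, ∑ i ∈ Finset.range (s + 1), (p i : ℂ) * Complex.exp (u * Complex.I) ^ i *
        ((sumProb p m (s - i) : ℂ) * Complex.exp (u * Complex.I) ^ (s - i)) =
        (sumProb p (m + 1) s : ℂ) * Complex.exp (u * Complex.I) ^ s := by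
      intro s
      rw [sumProb_succ, Complex.ofReal_sum, Finset.sum_mul]
      refine Finset.sum_congr rfl fun i hi => ?_
      rw [Finset.mem_range] at hi
      rw [← Nat.add_sub_cancel' (show i ≤ s by omega), Nat.add_sub_cancel_left, pow_add]
      push_cast
      ring
    simp only [h4] at h2 h3
    rw [ih.1.tsum_eq] at h2
    exact ⟨by rw [pow_succ']; exact h2, h3⟩

theorem summable_sumProb (hp : IsCritical p) (m : ℕ) : Summable (sumProb p m) := by
  simpa [abs_of_nonneg (hp.sumProb_nonneg m _)] using (hp.hasSum_charFn_pow 0 m).2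

theorem continuous_charFn (hp : IsCritical p) : Continuous (charFn p) := by
  refine continuous_tsum (fun i => by fun_prop) hp.hasSum.summable fun i u => ?_
  rw [norm_mul, norm_exp_pow, mul_one, Complex.norm_real, Real.norm_of_nonneg (hp.nonneg i)]

theorem norm_charFn_le_one (hp : IsCritical p) (u : ℝ) : ‖charFn p u‖ ≤ 1 := by
  refine tsum_of_norm_bounded hp.hasSum fun i => ?_
  rw [norm_mul, norm_exp_pow, mul_one, Complex.norm_real, Real.norm_of_nonneg (hp.nonneg i)]

theorem exp_pow_eq_one (hp : IsCritical p) {u : ℝ} (hu : ‖charFn p u‖ = 1) {i : ℕ}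
    (hi : p i ≠ 0) : Complex.exp (u * Complex.I) ^ i = 1 := by
  set z := Complex.exp (u * Complex.I) with hz
  set w := charFn p u with hw
  have h1 : HasSum (fun i : ℕ => (p i : ℂ) * z ^ i) w := (hp.summable_norm_charFn u).of_norm.hasSum
  have hsq : ∀ j : ℕ, ‖z ^ j - w‖ ^ 2 = 2 - 2 * (z ^ j * (starRingEnd ℂ) w).re := by
    intro j
    have h := Complex.normSq_sub (z ^ j) w
    rw [Complex.normSq_eq_norm_sq, Complex.normSq_eq_norm_sq, Complex.normSq_eq_norm_sq, hu,
      norm_exp_pow] at h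
    linarith
  have h2 : HasSum (fun j : ℕ => p j * ‖z ^ j - w‖ ^ 2) 0 := by
    have h3 := Complex.hasSum_re (h1.mul_right ((starRingEnd ℂ) w))
    have h4 : (w * (starRingEnd ℂ) w).re = 1 := by
      rw [Complex.mul_conj, Complex.normSq_eq_norm_sq, hu]; simp
    rw [h4] at h3
    convert! (hp.hasSum.mul_left 2).sub (h3.mul_left 2) using 1
    · ext j
      rw [hsq, mul_assoc, Complex.re_ofReal_mul]
      ring
    · norm_num
  have h5 := (hasSum_zero_iff_of_nonneg fun j => mul_nonneg (hp.nonneg j) (sq_nonneg _)).1 h2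
  have h6 : ∀ j, p j ≠ 0 → z ^ j = w := fun j hj => by
    have := congrFun h5 j
    simpa [hj, sub_eq_zero] using this
  rw [h6 i hi, ← h6 0 hp.pos_zero.ne', pow_zero]

/-- The span of the offspring distribution. -/
theorem exists_span (hp : IsCritical p) : ∃ h : ℕ, 0 < h ∧ (∀ i, p i ≠ 0 → h ∣ i) ∧
    ∀ u : ℝ, (∀ i, p i ≠ 0 → Complex.exp (u * Complex.I) ^ i = 1) →
      Complex.exp (u * Complex.I) ^ h = 1 := by
  obtain ⟨a, ha⟩ := Int.subgroup_cyclic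
    (AddSubgroup.closure ((fun i : ℕ => (i : ℤ)) '' {i | p i ≠ 0}))
  have hdvd : ∀ i, p i ≠ 0 → a.natAbs ∣ i := fun i hi => by
    have h1 : (i : ℤ) ∈ AddSubgroup.closure {a} := ha ▸ AddSubgroup.subset_closure ⟨i, hi, rfl⟩
    rw [← AddSubgroup.zmultiples_eq_closure, Int.mem_zmultiples_iff] at h1
    exact Int.natAbs_dvd_natAbs.2 h1
  refine ⟨a.natAbs, ?_, hdvd, fun u hu => ?_⟩
  · refine Nat.pos_of_ne_zero fun h0 => ?_
    have h1 : ∀ i : ℕ, (i : ℝ) * p i = 0 := fun i => by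
      by_cases hi : p i = 0
      · simp [hi]
      · have := hdvd i hi
        rw [h0, zero_dvd_iff] at this
        simp [this]
    have := hp.hasSum_mean.tsum_eq
    simp [h1] at this
  · have hmem : a ∈ AddSubgroup.closure ((fun i : ℕ => (i : ℤ)) '' {i | p i ≠ 0}) := by
      rw [ha]; exact AddSubgroup.subset_closure rfl
    have hz : Complex.exp (u * Complex.I) ^ a = 1 := by
      clear ha hdvd
      induction hmem using AddSubgroup.closure_induction with
      | mem x hx => obtain ⟨i, hi, rfl⟩ := hx; simpa using hu i hi
      | zero => simp
      | add x y _ _ hx hy => rw [zpow_add₀ (Complex.exp_ne_zero _), hx, hy, one_mul]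
      | neg x _ hx => rw [zpow_neg, hx, inv_one]
    rcases Int.natAbs_eq a with h | h
    · rw [h, zpow_natCast] at hz; exact hz
    · rw [h, zpow_neg, zpow_natCast, inv_eq_one] at hz; exact hz

end IsCritical

theorem dvd_of_sumProb_ne_zero {h : ℕ} (hh : ∀ i, p i ≠ 0 → h ∣ i) {m s : ℕ}
    (hs : sumProb p m s ≠ 0) : h ∣ s := by
  induction m generalizing s with
  | zero =>
    rw [sumProb, pow_zero, PowerSeries.coeff_one] at hs
    simp at hs
    simp [hs]
  | succ m ih =>
    rw [sumProb_succ] at hs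
    obtain ⟨i, hi, hne⟩ := Finset.exists_ne_zero_of_sum_ne_zero hs
    rw [Finset.mem_range] at hi
    rw [← Nat.add_sub_cancel' (show i ≤ s by omega)]
    exact dvd_add (hh i (left_ne_zero_of_mul hne)) (ih (right_ne_zero_of_mul hne))

theorem norm_charFn_lt_one (hp : IsCritical p) {h : ℕ} (h0 : 0 < h)
    (hh : ∀ u : ℝ, (∀ i, p i ≠ 0 → Complex.exp (u * Complex.I) ^ i = 1) →
      Complex.exp (u * Complex.I) ^ h = 1) {u : ℝ} (hu : |u| ≤ Real.pi / h) (hu0 : u ≠ 0) :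
    ‖charFn p u‖ < 1 := by
  refine lt_of_le_of_ne (hp.norm_charFn_le_one u) fun heq => hu0 ?_
  have h1 := hh u fun i hi => hp.exp_pow_eq_one heq hi
  rw [← Complex.exp_nat_mul, Complex.exp_eq_one_iff] at h1
  obtain ⟨n, hn⟩ := h1
  have hR : (0 : ℝ) < h := by exact_mod_cast h0
  have h2 : (h : ℝ) * u = n * (2 * Real.pi) := by
    have : ((h * u : ℝ) : ℂ) = ((n * (2 * Real.pi) : ℝ) : ℂ) := by
      apply mul_right_cancel₀ Complex.I_ne_zero
      push_cast
      linear_combination hn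
    exact_mod_cast this
  have h3 : |(n : ℝ)| * (2 * Real.pi) ≤ Real.pi := by
    have := congrArg abs h2
    rw [abs_mul, abs_mul, abs_of_pos hR, abs_of_pos Real.two_pi_pos] at this
    rw [← this]
    calc (h : ℝ) * |u| ≤ h * (Real.pi / h) := by gcongr
      _ = Real.pi := by field_simp
  have h4 : n = 0 := by
    by_contra hne
    have : (1 : ℝ) ≤ |(n : ℝ)| := by exact_mod_cast Int.one_le_abs hne
    nlinarith [Real.pi_pos]
  simpa [h4, hR.ne'] using h2

theorem integral_exp_lattice {h : ℕ} (h0 : 0 < h) (j : ℤ) :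
    ∫ u in (-(Real.pi / h))..(Real.pi / h), Complex.exp (u * Complex.I) ^ (h * j) =
      if j = 0 then ((2 * (Real.pi / h) : ℝ) : ℂ) else 0 := by
  have hR : (h : ℂ) ≠ 0 := by exact_mod_cast h0.ne'
  split_ifs with hj
  · simp [hj]; ring
  · have hc : ((h : ℂ) * j * Complex.I) ≠ 0 :=
      mul_ne_zero (mul_ne_zero hR (by exact_mod_cast hj)) Complex.I_ne_zero
    have h1 : ∀ u : ℝ, Complex.exp (u * Complex.I) ^ ((h : ℤ) * j) =
        Complex.exp ((h : ℂ) * j * Complex.I * u) := fun u => by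
      rw [← Complex.exp_int_mul]; congr 1; push_cast; ring
    simp only [h1]
    rw [integral_exp_mul_complex hc, div_eq_zero_iff]
    left
    rw [sub_eq_zero, Complex.exp_eq_exp_iff_exists_int]
    refine ⟨j, ?_⟩
    push_cast
    field_simp
    ring

/-- Fourier inversion for the sum of `m` independent offspring variables. -/
theorem integral_charFn_pow (hp : IsCritical p) {h : ℕ} (h0 : 0 < h)
    (hh : ∀ i, p i ≠ 0 → h ∣ i) (m : ℕ) {y : ℕ} (hy : h ∣ y) :
    ∫ u in (-(Real.pi / h))..(Real.pi / h),
      charFn p u ^ m * Complex.exp (u * Complex.I) ^ (-(y : ℤ)) =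
      ((2 * (Real.pi / h) * sumProb p m y : ℝ) : ℂ) := by
  have hnorm : ∀ (u : ℝ) (n : ℤ), ‖Complex.exp (u * Complex.I) ^ n‖ = 1 := fun u n => by
    rw [norm_zpow, Complex.norm_exp_ofReal_mul_I, one_zpow]
  have hsum := intervalIntegral.hasSum_integral_of_dominated_convergence
    (μ := volume) (a := -(Real.pi / h)) (b := Real.pi / h)
    (F := fun (s : ℕ) (u : ℝ) => (sumProb p m s : ℂ) * Complex.exp (u * Complex.I) ^ s *
      Complex.exp (u * Complex.I) ^ (-(y : ℤ)))
    (f := fun u => charFn p u ^ m * Complex.exp (u * Complex.I) ^ (-(y : ℤ)))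
    (fun s _ => sumProb p m s)
    (fun s => (Continuous.aestronglyMeasurable (by
      simp only [zpow_neg, zpow_natCast]
      exact Continuous.mul (by fun_prop) (Continuous.inv₀ (by fun_prop)
        fun u => pow_ne_zero _ (Complex.exp_ne_zero _)))))
    (fun s => Eventually.of_forall fun u _ => by
      rw [norm_mul, hnorm, mul_one, norm_mul, norm_exp_pow, mul_one, Complex.norm_real,
        Real.norm_of_nonneg (hp.sumProb_nonneg m s)])
    (Eventually.of_forall fun u _ => hp.summable_sumProb m)
    intervalIntegrable_const
    (Eventually.of_forall fun u _ => (hp.hasSum_charFn_pow u m).1.mul_right _)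
  refine hsum.unique ?_
  have hterm : ∀ s : ℕ, ∫ u in (-(Real.pi / h))..(Real.pi / h),
      (sumProb p m s : ℂ) * Complex.exp (u * Complex.I) ^ s *
        Complex.exp (u * Complex.I) ^ (-(y : ℤ)) =
      if s = y then ((2 * (Real.pi / h) * sumProb p m y : ℝ) : ℂ) else 0 := by
    intro s
    by_cases hs : sumProb p m s = 0
    · simp only [hs, Complex.ofReal_zero, zero_mul, intervalIntegral.integral_zero]
      split_ifs with h1
      · rw [← h1, hs]; simp
      · rfl
    · obtain ⟨a, rfl⟩ := dvd_of_sumProb_ne_zero hh hs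
      obtain ⟨b, rfl⟩ := hy
      have h1 : ∀ u : ℝ, (sumProb p m (h * a) : ℂ) * Complex.exp (u * Complex.I) ^ (h * a) *
          Complex.exp (u * Complex.I) ^ (-((h * b : ℕ) : ℤ)) =
          (sumProb p m (h * a) : ℂ) * Complex.exp (u * Complex.I) ^ (h * ((a : ℤ) - b)) := by
        intro u
        rw [mul_assoc, ← zpow_natCast, ← zpow_add₀ (Complex.exp_ne_zero _)]
        push_cast
        ring_nf
      simp only [h1, intervalIntegral.integral_const_mul]
      rw [integral_exp_lattice h0]
      have h2 : (a : ℤ) - b = 0 ↔ h * a = h * b := by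
        rw [Nat.mul_right_inj h0.ne']; omega
      simp only [h2]
      split_ifs with h3
      · rw [← h3]; push_cast; ring
      · simp
  simp only [hterm]
  exact hasSum_ite_eq y _

/-- A standardized offspring variable, realized on a probability space over `ℕ`. -/
theorem exists_standardization (hp : IsCritical p) :
    ∃ (μ : Measure ℕ) (X : ℕ → ℝ), IsProbabilityMeasure μ ∧ ∫ i, X i ∂μ = 0 ∧
      ∫ i, (X ^ 2) i ∂μ = 1 ∧
      ∀ u, charFun (μ.map X) (√(offspringVar p) * u) = centeredCharFn p u := by
  set σ := √(offspringVar p) with hσ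
  have hσ0 : 0 < σ := Real.sqrt_pos.2 hp.var_pos
  have hσ2 : σ ^ 2 = offspringVar p := Real.sq_sqrt hp.var_pos.le
  have hc : ∀ i, ENNReal.ofReal (p i) ≠ ⊤ := fun i => ENNReal.ofReal_ne_top
  refine ⟨Measure.sum fun i => ENNReal.ofReal (p i) • .dirac i, fun i => ((i : ℝ) - 1) / σ,
    hp.hasSum.isProbabilityMeasure_sum_dirac hp.nonneg, ?_, ?_, fun u => ?_⟩
  · rw [integral_sum_dirac hc]
    have h := (hp.hasSum_mean.sub hp.hasSum).mul_right σ⁻¹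
    simp only [sub_self, zero_mul] at h
    refine Eq.trans (tsum_congr fun i => ?_) h.tsum_eq
    rw [ENNReal.toReal_ofReal (hp.nonneg i), smul_eq_mul]
    ring
  · rw [integral_sum_dirac hc]
    have h := ((hp.summable_sq.hasSum.sub (hp.hasSum_mean.mul_left 2)).add hp.hasSum).mul_right
      (offspringVar p)⁻¹
    have h1 : ((∑' i : ℕ, (i : ℝ) ^ 2 * p i) - 2 * 1 + 1) * (offspringVar p)⁻¹ = 1 := by
      have := hp.var_pos.ne'
      rw [← div_eq_mul_inv, div_eq_one_iff_eq this, offspringVar]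
      ring
    rw [h1] at h
    refine Eq.trans (tsum_congr fun i => ?_) h.tsum_eq
    rw [ENNReal.toReal_ofReal (hp.nonneg i), smul_eq_mul, Pi.pow_apply, div_pow, hσ2]
    ring
  · rw [charFun_apply_real, integral_map (by fun_prop) (by fun_prop), integral_sum_dirac hc,
      centeredCharFn, charFn, ← tsum_mul_right]
    refine tsum_congr fun i => ?_
    rw [ENNReal.toReal_ofReal (hp.nonneg i), Complex.real_smul, mul_assoc (p i : ℂ) (_ ^ _) _,
      ← Complex.exp_nat_mul, ← Complex.exp_add]
    congr 2
    have : (σ : ℂ) ≠ 0 := by exact_mod_cast hσ0.ne'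
    push_cast
    field_simp
    ring

theorem centeredCharFn_isLittleO (hp : IsCritical p) :
    (fun u : ℝ => centeredCharFn p u - ((1 - offspringVar p * u ^ 2 / 2 : ℝ) : ℂ)) =o[𝓝 0]
      fun u : ℝ => u ^ 2 := by
  obtain ⟨μ, X, _, h1, h2, h3⟩ := exists_standardization hp
  have hσ2 : √(offspringVar p) ^ 2 = offspringVar p := Real.sq_sqrt hp.var_pos.le
  have h := taylor_charFun_two (P := μ) (X := X) (by fun_prop) h1 h2
  have ht : Tendsto (fun u : ℝ => √(offspringVar p) * u) (𝓝 0) (𝓝 0) := by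
    have : Continuous fun u : ℝ => √(offspringVar p) * u := by fun_prop
    simpa using this.tendsto 0
  have h4 := h.comp_tendsto ht
  simp only [Function.comp_def, h3, mul_pow, hσ2] at h4
  refine Asymptotics.IsLittleO.trans_isBigO (h4.congr_left fun u => ?_)
    (Asymptotics.isBigO_const_mul_self _ _ _)
  have : ((√(offspringVar p) : ℝ) : ℂ) ^ 2 = (offspringVar p : ℂ) := by exact_mod_cast hσ2
  push_cast
  rw [mul_pow, this]

theorem tendsto_centeredCharFn_pow (hp : IsCritical p) (t : ℝ) :
    Tendsto (fun n : ℕ => centeredCharFn p (t / √n) ^ n) atTop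
      (𝓝 ((Real.exp (-(offspringVar p / 2) * t ^ 2) : ℝ) : ℂ)) := by
  obtain ⟨μ, X, _, h1, h2, h3⟩ := exists_standardization hp
  have h := ProbabilityTheory.tendsto_charFun_inv_sqrt_mul_pow (P := μ) (X := X) (by fun_prop) h1 h2
    (√(offspringVar p) * t)
  have hσ2 : ((√(offspringVar p) : ℝ) : ℂ) ^ 2 = (offspringVar p : ℂ) := by
    exact_mod_cast Real.sq_sqrt hp.var_pos.le
  convert! h using 1
  · ext n
    rw [← h3]
    ring_nf
  · push_cast
    rw [mul_pow, hσ2]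
    ring_nf

/-- A Gaussian bound on the characteristic function on a full period. -/
theorem exists_norm_charFn_le (hp : IsCritical p) {h : ℕ} (h0 : 0 < h)
    (hh : ∀ u : ℝ, (∀ i, p i ≠ 0 → Complex.exp (u * Complex.I) ^ i = 1) →
      Complex.exp (u * Complex.I) ^ h = 1) :
    ∃ c : ℝ, 0 < c ∧ ∀ u : ℝ, |u| ≤ Real.pi / h → ‖charFn p u‖ ≤ Real.exp (-c * u ^ 2) := by
  have hv := hp.var_pos
  set v := offspringVar p with hv_def
  have hR : (0 : ℝ) < h := by exact_mod_cast h0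
  have hnear : ∃ δ > 0, ∀ u : ℝ, |u| < δ → ‖charFn p u‖ ≤ Real.exp (-(v / 4) * u ^ 2) := by
    have h1 := (centeredCharFn_isLittleO hp).def (show 0 < v / 4 by positivity)
    have h2 : ∀ᶠ u : ℝ in 𝓝 0, v * u ^ 2 / 2 < 1 := by
      have : Continuous fun u : ℝ => v * u ^ 2 / 2 := by fun_prop
      exact (this.tendsto 0).eventually_lt_const (by simp)
    obtain ⟨δ, hδ, h3⟩ := Metric.eventually_nhds_iff.1 (h1.and h2)
    refine ⟨δ, hδ, fun u hu => ?_⟩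
    obtain ⟨h4, h5⟩ := h3 (by simpa using hu)
    rw [← hv_def] at h4
    rw [← norm_centeredCharFn]
    have h6 : ‖((1 - v * u ^ 2 / 2 : ℝ) : ℂ)‖ = 1 - v * u ^ 2 / 2 := by
      rw [Complex.norm_real, Real.norm_of_nonneg (by linarith)]
    have h7 := norm_add_le (centeredCharFn p u - ((1 - v * u ^ 2 / 2 : ℝ) : ℂ))
      ((1 - v * u ^ 2 / 2 : ℝ) : ℂ)
    rw [sub_add_cancel, h6] at h7
    rw [Real.norm_of_nonneg (sq_nonneg u)] at h4
    have h8 := Real.add_one_le_exp (-(v / 4) * u ^ 2)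
    linarith
  obtain ⟨δ, hδ, hnear⟩ := hnear
  have hcomp : IsCompact (Set.Icc (-(Real.pi / h)) (Real.pi / h) \ Metric.ball (0 : ℝ) δ) :=
    isCompact_Icc.diff Metric.isOpen_ball
  obtain ⟨ε, hε, hfar⟩ := hcomp.exists_forall_le'
    (f := fun u => 1 - ‖charFn p u‖) (a := 0)
    (continuous_const.sub hp.continuous_charFn.norm).continuousOn (by
      rintro u ⟨hu1, hu2⟩
      refine sub_pos.2 (norm_charFn_lt_one hp h0 hh (abs_le.2 hu1) ?_)
      rintro rfl
      exact hu2 (Metric.mem_ball_self hδ))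
  have hπ : 0 < Real.pi / h := by positivity
  refine ⟨min (v / 4) (ε / (Real.pi / h) ^ 2), by positivity, fun u hu => ?_⟩
  by_cases huδ : |u| < δ
  · refine (hnear u huδ).trans (Real.exp_le_exp.2 ?_)
    have := min_le_left (v / 4) (ε / (Real.pi / h) ^ 2)
    nlinarith [sq_nonneg u]
  · have h1 := hfar u ⟨abs_le.1 hu, by simpa using huδ⟩
    have h2 : min (v / 4) (ε / (Real.pi / h) ^ 2) * u ^ 2 ≤ ε := by
      calc _ ≤ ε / (Real.pi / h) ^ 2 * (Real.pi / h) ^ 2 := by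
            refine mul_le_mul (min_le_right _ _) (sq_le_sq' ?_ ?_) (sq_nonneg u) (by positivity)
            · exact (abs_le.1 hu).1
            · exact (abs_le.1 hu).2
        _ = ε := by field_simp
    have h3 := Real.add_one_le_exp (-min (v / 4) (ε / (Real.pi / h) ^ 2) * u ^ 2)
    linarith


/-- The local upper bound for the sum of `m` independent offspring variables. -/
theorem exists_sumProb_le (hp : IsCritical p) :
    ∃ C : ℝ, 0 < C ∧ ∀ m y : ℕ, sumProb p m y ≤ C / √(m + 1) := by
  obtain ⟨h, h0, hdvd, hspan⟩ := hp.exists_span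
  obtain ⟨c, hc, hchar⟩ := exists_norm_charFn_le hp h0 hspan
  have hR : (0 : ℝ) < h := by exact_mod_cast h0
  have hπ : 0 < Real.pi / h := by positivity
  set K : ℝ := √(Real.pi / c) / (2 * (Real.pi / h)) with hK
  have hK0 : 0 < K := by positivity
  refine ⟨max 1 (√2 * K), by positivity, fun m y => ?_⟩
  by_cases hy : h ∣ y
  swap
  · rw [show sumProb p m y = 0 from by_contra fun hne => hy (dvd_of_sumProb_ne_zero hdvd hne)]
    positivity
  obtain rfl | hm := Nat.eq_zero_or_pos m
  · have : sumProb p 0 y ≤ 1 := by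
      rw [sumProb, pow_zero, PowerSeries.coeff_one]
      split_ifs <;> norm_num
    simpa using this.trans (le_max_left _ _)
  have hmR : (1 : ℝ) ≤ m := by exact_mod_cast hm
  have hcm : 0 < c * m := by positivity
  have hint := integrable_exp_neg_mul_sq hcm
  have h1 : 2 * (Real.pi / h) * sumProb p m y ≤ √(Real.pi / (c * m)) := by
    calc 2 * (Real.pi / h) * sumProb p m y
        = ‖∫ u in (-(Real.pi / h))..(Real.pi / h),
            charFn p u ^ m * Complex.exp (u * Complex.I) ^ (-(y : ℤ))‖ := by
          rw [integral_charFn_pow hp h0 hdvd m hy, Complex.norm_real, Real.norm_of_nonneg]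
          exact mul_nonneg (by positivity) (hp.sumProb_nonneg m y)
      _ ≤ ∫ u in (-(Real.pi / h))..(Real.pi / h), Real.exp (-(c * m) * u ^ 2) := by
          refine intervalIntegral.norm_integral_le_of_norm_le (by linarith)
            (Eventually.of_forall fun u hu => ?_) hint.intervalIntegrable
          rw [norm_mul, norm_zpow, Complex.norm_exp_ofReal_mul_I, one_zpow, mul_one, norm_pow]
          calc ‖charFn p u‖ ^ m ≤ Real.exp (-c * u ^ 2) ^ m := by
                gcongr
                exact hchar u (abs_le.2 ⟨hu.1.le, hu.2⟩)
            _ = Real.exp (-(c * m) * u ^ 2) := by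
                rw [← Real.exp_nat_mul]
                ring_nf
      _ ≤ ∫ u, Real.exp (-(c * m) * u ^ 2) := by
          rw [intervalIntegral.integral_of_le (by linarith)]
          exact setIntegral_le_integral hint (Eventually.of_forall fun u => (Real.exp_pos _).le)
      _ = √(Real.pi / (c * m)) := integral_gaussian _
  have h2 : √(m + 1 : ℝ) ≤ √2 * √m := by
    rw [← Real.sqrt_mul (by norm_num)]
    exact Real.sqrt_le_sqrt (by linarith)
  have h3 : sumProb p m y ≤ K / √m := by
    rw [hK, div_div, le_div_iff₀ (by positivity)]
    rw [← div_div, Real.sqrt_div (by positivity), le_div_iff₀ (by positivity)] at h1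
    linarith
  calc sumProb p m y ≤ K / √m := h3
    _ ≤ √2 * K / √(m + 1) := by
        rw [div_le_div_iff₀ (by positivity) (by positivity)]
        nlinarith
    _ ≤ _ := by gcongr; exact le_max_right _ _

/-- The central limit theorem at the level of the inversion integral, for the value `n - 1`. -/
theorem tendsto_sqrt_mul_integral (hp : IsCritical p) {h : ℕ} (h0 : 0 < h) {c : ℝ} (hc : 0 < c)
    (hchar : ∀ u : ℝ, |u| ≤ Real.pi / h → ‖charFn p u‖ ≤ Real.exp (-c * u ^ 2)) :
    Tendsto (fun n : ℕ => ((√n : ℝ) : ℂ) * ∫ u in (-(Real.pi / h))..(Real.pi / h),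
      centeredCharFn p u ^ n * Complex.exp (u * Complex.I)) atTop
      (𝓝 ((√(Real.pi / (offspringVar p / 2)) : ℝ) : ℂ)) := by
  have hR : (0 : ℝ) < h := by exact_mod_cast h0
  have hπ : 0 < Real.pi / h := by positivity
  have hcont : Continuous (centeredCharFn p) := by
    have := hp.continuous_charFn
    unfold centeredCharFn
    fun_prop
  let S : ℕ → Set ℝ := fun n => Set.Ioc (-(Real.pi / h) * √n) (Real.pi / h * √n)
  have hlim := tendsto_integral_of_dominated_convergence (μ := volume)
    (F := fun (n : ℕ) => (S n).indicator fun t : ℝ =>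
      centeredCharFn p (t / √n) ^ n * Complex.exp ((t / √n : ℝ) * Complex.I))
    (f := fun t : ℝ => ((Real.exp (-(offspringVar p / 2) * t ^ 2) : ℝ) : ℂ))
    (fun t => Real.exp (-c * t ^ 2))
    (fun n => (Continuous.aestronglyMeasurable (by fun_prop)).indicator measurableSet_Ioc)
    (integrable_exp_neg_mul_sq hc)
    (fun n => Eventually.of_forall fun t => ?_)
    (Eventually.of_forall fun t => ?_)
  · rw [integral_complex_ofReal, integral_gaussian] at hlim
    refine hlim.congr' ?_
    filter_upwards [eventually_gt_atTop 0] with n hn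
    have hs : 0 < √(n : ℝ) := Real.sqrt_pos.2 (by exact_mod_cast hn)
    have h1 := intervalIntegral.integral_comp_div
      (a := -(Real.pi / h) * √n) (b := Real.pi / h * √n)
      (fun u : ℝ => centeredCharFn p u ^ n * Complex.exp (u * Complex.I)) hs.ne'
    rw [mul_div_cancel_right₀ _ hs.ne', mul_div_cancel_right₀ _ hs.ne', Complex.real_smul] at h1
    rw [← h1, integral_indicator measurableSet_Ioc, intervalIntegral.integral_of_le]
    nlinarith
  · by_cases ht : t ∈ S n
    · have hs : 0 < √(n : ℝ) := by
        have := ht.1.trans_le ht.2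
        nlinarith
      rw [Set.indicator_of_mem ht, norm_mul, Complex.norm_exp_ofReal_mul_I, mul_one, norm_pow,
        norm_centeredCharFn]
      calc ‖charFn p (t / √n)‖ ^ n ≤ Real.exp (-c * (t / √n) ^ 2) ^ n := by
            gcongr
            refine hchar _ (abs_le.2 ⟨?_, ?_⟩)
            · exact (le_div_iff₀ hs).2 ht.1.le
            · exact (div_le_iff₀ hs).2 ht.2
        _ = Real.exp (-c * t ^ 2) := by
            rw [← Real.exp_nat_mul, div_pow, Real.sq_sqrt (Nat.cast_nonneg n)]
            have : (n : ℝ) ≠ 0 := fun h => hs.ne' (by rw [h, Real.sqrt_zero])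
            congr 1
            field_simp
    · rw [Set.indicator_of_notMem ht, norm_zero]
      exact (Real.exp_pos _).le
  · have hexp : Tendsto (fun n : ℕ => Complex.exp ((t / √n : ℝ) * Complex.I)) atTop (𝓝 1) := by
      have h1 : Tendsto (fun n : ℕ => t / √(n : ℝ)) atTop (𝓝 0) :=
        (Real.tendsto_sqrt_atTop.comp tendsto_natCast_atTop_atTop).const_div_atTop t
      have h2 : Continuous fun x : ℝ => Complex.exp (x * Complex.I) := by fun_prop
      simpa [Function.comp_def] using (h2.tendsto 0).comp h1
    have h3 := (tendsto_centeredCharFn_pow hp t).mul hexp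
    rw [mul_one] at h3
    refine h3.congr' ?_
    have h4 : Tendsto (fun n : ℕ => Real.pi / h * √(n : ℝ)) atTop atTop :=
      (Real.tendsto_sqrt_atTop.comp tendsto_natCast_atTop_atTop).const_mul_atTop hπ
    filter_upwards [h4.eventually_gt_atTop |t|] with n hn
    rw [Set.indicator_of_mem]
    have := abs_lt.1 hn
    exact ⟨by linarith, this.2.le⟩

/-- The local lower bound for the sum of `n` independent offspring variables. -/
theorem exists_le_sumProb (hp : IsCritical p) :
    ∃ c : ℝ, 0 < c ∧ ∃ N : ℕ, ∀ n, N ≤ n → 0 < n → sumProb p n (n - 1) ≠ 0 →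
      c / √n ≤ sumProb p n (n - 1) := by
  obtain ⟨h, h0, hdvd, hspan⟩ := hp.exists_span
  obtain ⟨c, hc, hchar⟩ := exists_norm_charFn_le hp h0 hspan
  have hR : (0 : ℝ) < h := by exact_mod_cast h0
  have hv := hp.var_pos
  set L : ℝ := √(Real.pi / (offspringVar p / 2)) with hL
  have hL0 : 0 < L := by positivity
  have hlim := (Complex.continuous_re.tendsto _).comp (tendsto_sqrt_mul_integral hp h0 hc hchar)
  rw [← hL, Complex.ofReal_re] at hlim
  obtain ⟨N, hN⟩ := eventually_atTop.1 (hlim.eventually_const_lt (half_lt_self hL0))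
  refine ⟨L / 2 / (2 * (Real.pi / h)), by positivity, N, fun n hn hn0 hne => ?_⟩
  have h1 := hN n hn
  have hs : 0 < √(n : ℝ) := Real.sqrt_pos.2 (by exact_mod_cast hn0)
  have h2 : ∀ u : ℝ, centeredCharFn p u ^ n * Complex.exp (u * Complex.I) =
      charFn p u ^ n * Complex.exp (u * Complex.I) ^ (-((n - 1 : ℕ) : ℤ)) := fun u => by
    obtain ⟨k, rfl⟩ := Nat.exists_eq_add_of_lt hn0
    rw [centeredCharFn, mul_pow, mul_assoc, ← Complex.exp_nat_mul, ← Complex.exp_add,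
      ← Complex.exp_int_mul]
    congr 2
    push_cast
    simp
    ring
  simp only [Function.comp_apply, h2] at h1
  rw [integral_charFn_pow hp h0 hdvd n (dvd_of_sumProb_ne_zero hdvd hne), ← Complex.ofReal_mul,
    Complex.ofReal_re] at h1
  rw [div_div, div_le_iff₀ (by positivity)]
  linarith

/-- `E Z_k` is at most of order `n^{3/2} k^{-3/2} (n - k + 1)^{-1/2}`. -/
theorem exists_condExp_Zk_le (hp : IsCritical p) :
    ∃ K : ℝ, 0 < K ∧ ∃ N : ℕ, ∀ k n : ℕ, 0 < k → k ≤ n → N ≤ n → n ∈ gwSupport p →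
      condExp p n (fun T => (Zk k T : ℝ)) ≤
        K * n * √n / (k * √k * √((n - k : ℕ) + 1)) := by
  obtain ⟨C, hC, hupper⟩ := exists_sumProb_le hp
  obtain ⟨c, hc, N, hlower⟩ := exists_le_sumProb hp
  refine ⟨C * C / c, by positivity, N, fun k n hk hkn hn hmem => ?_⟩
  have hn0 : 0 < n := hmem.1
  have hkR : (0 : ℝ) < k := by exact_mod_cast hk
  have hnR : (0 : ℝ) < n := by exact_mod_cast hn0
  have hT := hmem.2
  rw [treeSum_eq_sumProb hn0] at hT
  have hne : sumProb p n (n - 1) ≠ 0 := fun h => by simp [h] at hT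
  have h1 := hlower n hn hn0 hne
  have h2 : sumProb p k (k - 1) ≤ C / √k :=
    (hupper k (k - 1)).trans (by gcongr; linarith)
  have h3 := hupper (n - k) (n - k)
  rw [condExp_Zk hk hkn, treeSum_eq_sumProb hk, treeSum_eq_sumProb hn0]
  calc sumProb p k (k - 1) / k * sumProb p (n - k) (n - k) / (sumProb p n (n - 1) / n)
      ≤ C / √k / k * (C / √((n - k : ℕ) + 1)) / (c / √n / n) := by
        have := hp.sumProb_nonneg (n - k) (n - k)
        gcongr
    _ = _ := by field_simp

theorem sum_one_div_mul_sqrt_sqrt_le {M n : ℕ} (hM : 0 < M) (hn : M ≤ n) :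
    ∑ k ∈ Finset.Icc M n, 1 / ((k : ℝ) * √√k) ≤ 8 / √√M := by
  have hstep : ∀ k : ℕ, 0 < k → 1 / ((k : ℝ) * √√k) ≤ 8 / √√k - 8 / √√(k + 1 : ℕ) := by
    intro k hk
    have hkR : (1 : ℝ) ≤ k := by exact_mod_cast hk
    have hr : 0 < √√(k : ℝ) := by positivity
    have hs : 0 < √√((k + 1 : ℕ) : ℝ) := by positivity
    have hr4 : √√(k : ℝ) ^ 4 = k := by
      rw [show 4 = 2 * 2 from rfl, pow_mul, Real.sq_sqrt (by positivity),
        Real.sq_sqrt (by positivity)]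
    have hs4 : √√((k + 1 : ℕ) : ℝ) ^ 4 = k + 1 := by
      rw [show 4 = 2 * 2 from rfl, pow_mul, Real.sq_sqrt (by positivity),
        Real.sq_sqrt (by positivity)]
      push_cast
      ring
    have hle : √√(k : ℝ) ≤ √√((k + 1 : ℕ) : ℝ) := by gcongr; omega
    generalize √√(k : ℝ) = r at *
    generalize √√((k + 1 : ℕ) : ℝ) = s at *
    rw [div_sub_div _ _ hr.ne' hs.ne', div_le_div_iff₀ (by positivity) (by positivity)]
    have h1 : (s - r) * (4 * s ^ 3) ≥ 1 := by
      have : (s - r) * ((s + r) * (s ^ 2 + r ^ 2)) = 1 := by linear_combination hs4 - hr4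
      have h2 : (s + r) * (s ^ 2 + r ^ 2) ≤ 4 * s ^ 3 := by
        have : r ^ 2 ≤ s ^ 2 := by gcongr
        nlinarith
      nlinarith
    have h2 : s ^ 4 ≤ 2 * k := by linarith
    have h3 : s * (4 * s ^ 3) ≤ 8 * k := by nlinarith
    have h4 : s ≤ 8 * k * (s - r) := by
      have : s * 1 ≤ s * ((s - r) * (4 * s ^ 3)) := by gcongr
      nlinarith
    nlinarith
  have htel : ∑ k ∈ Finset.Icc M n, 1 / ((k : ℝ) * √√k) ≤ 8 / √√M - 8 / √√(n + 1 : ℕ) := by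
    induction n, hn using Nat.le_induction with
    | base => simpa using hstep M hM
    | succ n hn ih =>
      rw [Finset.sum_Icc_succ_top (by omega)]
      linarith [hstep (n + 1) (by omega)]
  have : 0 ≤ 8 / √√((n + 1 : ℕ) : ℝ) := by positivity
  linarith

theorem sum_range_one_div_sqrt_le (n : ℕ) :
    ∑ j ∈ Finset.range n, 1 / √((j : ℝ) + 1) ≤ 2 * √n := by
  induction n with
  | zero => simp
  | succ n ih =>
    rw [Finset.sum_range_succ]
    push_cast
    have h1 : √((n : ℝ) + 1) ^ 2 = n + 1 := Real.sq_sqrt (by positivity)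
    have h2 : √(n : ℝ) ^ 2 = n := Real.sq_sqrt (by positivity)
    have h3 : 0 < √((n : ℝ) + 1) := by positivity
    have h4 : 1 / √((n : ℝ) + 1) ≤ 2 * √((n : ℝ) + 1) - 2 * √n := by
      rw [div_le_iff₀ h3]
      nlinarith [sq_nonneg (√((n : ℝ) + 1) - √n)]
    linarith

theorem sum_Icc_one_div_sqrt_le {M n : ℕ} (hM : 0 < M) :
    ∑ k ∈ Finset.Icc M n, 1 / √(((n - k : ℕ) : ℝ) + 1) ≤ 2 * √n := by
  have hinj : Set.InjOn (fun k => n - k) (Finset.Icc M n : Set ℕ) := fun a ha b hb hab => by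
    simp only [Finset.coe_Icc, Set.mem_Icc] at ha hb hab
    omega
  rw [← Finset.sum_image (f := fun j : ℕ => 1 / √((j : ℝ) + 1)) hinj]
  refine le_trans (Finset.sum_le_sum_of_subset_of_nonneg ?_ fun _ _ _ => by positivity)
    (sum_range_one_div_sqrt_le n)
  intro j hj
  simp only [Finset.mem_image, Finset.mem_Icc, Finset.mem_range] at hj ⊢
  omega

theorem sqrt_div_mul_le {k j n : ℝ} (hk : 1 ≤ k) (hj : 1 ≤ j) (hn : n + 1 = k + j) :
    √n / √j * (1 / (k * √√k)) ≤ 2 * (1 / (k * √√k)) + 2 / (√n * √√n) * (1 / √j) := by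
  have hn1 : 1 ≤ n := by linarith
  have hsk : √k ^ 2 = k := Real.sq_sqrt (by linarith)
  have hsj : √j ^ 2 = j := Real.sq_sqrt (by linarith)
  have hsn : √n ≤ √k + √j :=
    Real.sqrt_le_iff.2 ⟨by positivity, by nlinarith [Real.sqrt_nonneg k, Real.sqrt_nonneg j]⟩
  have hj0 : 0 < √j := by positivity
  have hk0 : 0 < √k := by positivity
  have hkk : 0 < √√k := by positivity
  have hn0 : 0 < √n := by positivity
  have h1 : √n / √j * (1 / (k * √√k)) ≤ 1 / (k * √√k) + √k / √j * (1 / (k * √√k)) := by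
    have : √n / √j ≤ 1 + √k / √j := by
      rw [div_le_iff₀ hj0, add_mul, div_mul_cancel₀ _ hj0.ne']
      linarith
    calc _ ≤ (1 + √k / √j) * (1 / (k * √√k)) := by gcongr
      _ = _ := by ring
  have h2 : √k / √j * (1 / (k * √√k)) ≤ 1 / (k * √√k) + 2 / (√n * √√n) * (1 / √j) := by
    rcases le_total k j with hkj | hjk
    · have : √k / √j ≤ 1 := (div_le_one hj0).2 (Real.sqrt_le_sqrt hkj)
      have h3 : √k / √j * (1 / (k * √√k)) ≤ 1 * (1 / (k * √√k)) := by gcongr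
      have : 0 ≤ 2 / (√n * √√n) * (1 / √j) := by positivity
      linarith
    · have h3 : √k / √j * (1 / (k * √√k)) = 1 / (√k * √√k) * (1 / √j) := by
        nth_rewrite 2 [← hsk]
        field_simp
      have h4 : √n * √√n ≤ 2 * (√k * √√k) := by
        have h5 : √n ≤ √2 * √k := by
          rw [← Real.sqrt_mul (by norm_num)]
          exact Real.sqrt_le_sqrt (by linarith)
        have h6 : √√n ≤ √2 * √√k := by
          rw [← Real.sqrt_mul (by norm_num)]
          refine Real.sqrt_le_sqrt (h5.trans ?_)
          gcongr
          nlinarith [Real.sq_sqrt (show (0 : ℝ) ≤ 2 by norm_num), Real.sqrt_nonneg 2]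
        calc √n * √√n ≤ √2 * √k * (√2 * √√k) := by gcongr
          _ = (√2 * √2) * (√k * √√k) := by ring
          _ = _ := by rw [Real.mul_self_sqrt (by norm_num)]
      have h5 : 1 / (√k * √√k) ≤ 2 / (√n * √√n) := by
        rw [div_le_div_iff₀ (by positivity) (by positivity)]
        linarith
      have h6 : 0 ≤ 1 / (k * √√k) := by positivity
      rw [h3]
      have : 1 / (√k * √√k) * (1 / √j) ≤ 2 / (√n * √√n) * (1 / √j) := by gcongr
      linarith
  linarith

theorem sum_sqrt_div_mul_le {M n : ℕ} (hM : 0 < M) (hn : M ≤ n) :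
    ∑ k ∈ Finset.Icc M n, √(n : ℝ) / √((n - k : ℕ) + 1) * (1 / (k * √√k)) ≤ 20 / √√M := by
  have hMR : (0 : ℝ) < M := by exact_mod_cast hM
  have hnR : (M : ℝ) ≤ n := by exact_mod_cast hn
  have hn0 : (0 : ℝ) < n := hMR.trans_le hnR
  calc ∑ k ∈ Finset.Icc M n, √(n : ℝ) / √((n - k : ℕ) + 1) * (1 / (k * √√k))
      ≤ ∑ k ∈ Finset.Icc M n, (2 * (1 / ((k : ℝ) * √√k)) +
          2 / (√n * √√n) * (1 / √(((n - k : ℕ) : ℝ) + 1))) := by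
        refine Finset.sum_le_sum fun k hk => ?_
        rw [Finset.mem_Icc] at hk
        refine sqrt_div_mul_le ?_ ?_ ?_
        · exact_mod_cast hM.trans_le hk.1
        · simp
        · rw [Nat.cast_sub hk.2]; ring
    _ ≤ 2 * (8 / √√M) + 2 / (√n * √√n) * (2 * √n) := by
        rw [Finset.sum_add_distrib, ← Finset.mul_sum, ← Finset.mul_sum]
        gcongr
        · exact sum_one_div_mul_sqrt_sqrt_le hM hn
        · exact sum_Icc_one_div_sqrt_le hM
    _ = 16 / √√M + 4 / √√n := by field_simp; ring
    _ ≤ 16 / √√M + 4 / √√M := by gcongr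
    _ = 20 / √√M := by ring

theorem log_le_log_mul_sqrt_sqrt_div {x y : ℝ} (hx : Real.exp 4 ≤ x) (hxy : x ≤ y) :
    Real.log y ≤ Real.log x * (√√y / √√x) := by
  have h0 : 0 < x := (Real.exp_pos 4).trans_le hx
  have hsq : ∀ z : ℝ, 0 < z → √√z = z ^ (1 / 4 : ℝ) := fun z hz => by
    rw [Real.sqrt_eq_rpow, Real.sqrt_eq_rpow, ← Real.rpow_mul hz.le]
    norm_num
  have h4 : ((1 / 4 : ℝ))⁻¹ = 4 := by norm_num
  have h := Real.log_div_self_rpow_antitoneOn (a := 1 / 4) (by norm_num)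
    (show x ∈ Set.Ici _ by rw [h4]; exact hx)
    (show y ∈ Set.Ici _ by rw [h4]; exact hx.trans hxy) hxy
  simp only [← hsq x h0, ← hsq y (h0.trans_le hxy)] at h
  rw [div_le_iff₀ (Real.sqrt_pos.2 (Real.sqrt_pos.2 (h0.trans_le hxy)))] at h
  exact h.trans_eq (by ring)

theorem exists_sum_condExp_mul_log_le (hp : IsCritical p) :
    ∃ C : ℝ, ∃ n₀ : ℕ, 0 < C ∧ 1 ≤ n₀ ∧ ∀ M n : ℕ, n₀ ≤ M → M ≤ n → n ∈ gwSupport p →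
      ∑ k ∈ Finset.Icc M n, condExp p n (fun T => (Zk k T : ℝ)) * Real.log k ≤
        C * n * Real.log M / √M := by
  obtain ⟨K, hK, N, hZ⟩ := exists_condExp_Zk_le hp
  refine ⟨20 * K, max (N + 1) ⌈Real.exp 4⌉₊, by positivity, by simp, fun M n hM hMn hn => ?_⟩
  have hM0 : 0 < M := by have := le_max_left (N + 1) ⌈Real.exp 4⌉₊; omega
  have hNn : N ≤ n := by have := le_max_left (N + 1) ⌈Real.exp 4⌉₊; omega
  have hexp : Real.exp 4 ≤ M :=
    (Nat.le_ceil _).trans (by exact_mod_cast (le_max_right _ _).trans hM)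
  have hMR : (1 : ℝ) ≤ M := by exact_mod_cast hM0
  have hlogM : 0 ≤ Real.log M := Real.log_nonneg hMR
  calc ∑ k ∈ Finset.Icc M n, condExp p n (fun T => (Zk k T : ℝ)) * Real.log k
      ≤ ∑ k ∈ Finset.Icc M n, K * n * Real.log M / √√M *
          (√(n : ℝ) / √((n - k : ℕ) + 1) * (1 / (k * √√k))) := by
        refine Finset.sum_le_sum fun k hk => ?_
        rw [Finset.mem_Icc] at hk
        have hkR : (1 : ℝ) ≤ k := by exact_mod_cast hM0.trans_le hk.1
        have h1 := hZ k n (by omega) hk.2 hNn hn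
        have h2 := log_le_log_mul_sqrt_sqrt_div hexp (show (M : ℝ) ≤ k by exact_mod_cast hk.1)
        have h3 : √√(k : ℝ) ^ 2 = √k := Real.sq_sqrt (Real.sqrt_nonneg _)
        calc condExp p n (fun T => (Zk k T : ℝ)) * Real.log k
            ≤ K * n * √n / (k * √k * √((n - k : ℕ) + 1)) * (Real.log M * (√√k / √√M)) := by
              have := Real.log_nonneg hkR
              gcongr
          _ = _ := by
              have h4 : 0 < √√(k : ℝ) := by positivity
              generalize √√(k : ℝ) = r at *
              rw [← h3]
              field_simp
    _ ≤ K * n * Real.log M / √√M * (20 / √√M) := by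
        rw [← Finset.mul_sum]
        gcongr
        exact sum_sqrt_div_mul_le hM0 hMn
    _ = 20 * K * n * Real.log M / √M := by
        nth_rewrite 3 [← Real.sq_sqrt (Real.sqrt_nonneg (M : ℝ))]
        field_simp

end GaltonWatson

/-- a bound on `Σ_{k=M}^{n} E_{τ_n}[Z_k]·log k`. -/
theorem stmt_2 (p : ℕ → ℝ)
    (hp_nonneg : ∀ i, 0 ≤ p i)
    (hp_sum : ∑' i : ℕ, p i = 1)
    (hp_mean : ∑' i : ℕ, (i : ℝ) * p i = 1)
    (hp_sq : Summable (fun i : ℕ => (i : ℝ) ^ 2 * p i))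
    (hp_var : 1 < ∑' i : ℕ, (i : ℝ) ^ 2 * p i) :
    ∃ C : ℝ, ∃ n₀ : ℕ, 0 < C ∧ 1 ≤ n₀ ∧
      ∀ M n : ℕ, n₀ ≤ M → M ≤ n → n ∈ gwSupport p →
        ∑ k ∈ Finset.Icc M n, condExp p n (fun T => (Zk k T : ℝ)) * Real.log k ≤
          C * (n : ℝ) * Real.log M / Real.sqrt M +
            (2 + 4 * Real.sqrt 2 * gwAlpha p) * (n : ℝ) ^ ((3 : ℝ) / 4) * Real.log n := by
  have hs : ∀ f : ℕ → ℝ, ∑' i, f i = 1 → HasSum f 1 := fun f hf => by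
    have : Summable f := by
      by_contra h
      rw [tsum_eq_zero_of_not_summable h] at hf
      norm_num at hf
    exact hf ▸ this.hasSum
  obtain ⟨C, n₀, hC, hn₀, h⟩ := GaltonWatson.exists_sum_condExp_mul_log_le
    (p := p) ⟨hp_nonneg, hs _ hp_sum, hs _ hp_mean, hp_sq, hp_var⟩
  refine ⟨C, n₀, hC, hn₀, fun M n hM hMn hn => (h M n hM hMn hn).trans ?_⟩
  have hα : 0 ≤ gwAlpha p := by unfold gwAlpha; positivity
  have hlog : 0 ≤ Real.log n := Real.log_natCast_nonneg n
  exact le_add_of_nonneg_right (by positivity)
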